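/- arXiv:math-ph/0402031 — 2 statements merged into one kernel-verified Lean document; each statement's English description precedes it below -/
import Mathlib

section
/- (Proposition 1, orthogonal case.) Let S be an invertible N×N complex matrix with Sᵀ = S = S⁻¹. Let J ∈ M_N(ℂ) with SJᵀS⁻¹ = −J, and let q₀ : ℝ → M_N(ℂ) be differentiable with S q₀(x)ᵀ S⁻¹ = −q₀(x) for all x. Let λ₁⁺, λ₁⁻ ∈ ℂ and let χ⁺, χ⁻ : ℝ → GL_N(ℂ) be differentiable, satisfy the ZS equations i·(χ±)'(x) + q₀(x)χ±(x) − λ₁± J χ±(x) = 0, and lie in the orthogonal group: χ±(x) S (χ±(x))ᵀ = S for all x. Let n₀, m₀ ∈ ℂ^N be constant column vectors with m₀ᵀSm₀ = 0 and n₀ᵀSn₀ = 0, and suppose ρ(x) := m₀ᵀ χ⁻(x)⁻¹ χ⁺(x) n₀ ≠ 0 for all x. Define π₁(x) = χ⁺(x) n₀ · ρ(x)⁻¹ · m₀ᵀ χ⁻(x)⁻¹, π₋₁(x) = S π₁(x)ᵀ S⁻¹, and q₁(x) = q₀(x) + (λ₁⁻ − λ₁⁺)[J, π₁(x) − π₋₁(x)].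 Then for all x: i·π₁'(x) + q₁(x)π₁(x) − π₁(x)q₀(x) − λ₁⁻[J, π₁(x)] = 0 and i·π₋₁'(x) + q₁(x)π₋₁(x) − π₋₁(x)q₀(x) − λ₁⁺[J, π₋₁(x)] = 0. -/
open Matrix

attribute [local instance] Matrix.normedAddCommGroup Matrix.normedSpace

theorem HasDerivAt.matrix_mul {l m n : Type*} [Fintype l] [Fintype m] [Fintype n]
    {A : ℝ → Matrix l m ℂ} {B : ℝ → Matrix m n ℂ}
    {A' : Matrix l m ℂ} {B' : Matrix m n ℂ} {x : ℝ}
    (hA : HasDerivAt A A' x) (hB : HasDerivAt B B' x) :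
    HasDerivAt (fun y => A y * B y) (A' * B x + A x * B') x := by
  have hA' : ∀ i j, HasDerivAt (fun y => A y i j) (A' i j) x := fun i j =>
    hasDerivAt_pi.1 (hasDerivAt_pi.1 hA i) j
  have hB' : ∀ i j, HasDerivAt (fun y => B y i j) (B' i j) x := fun i j =>
    hasDerivAt_pi.1 (hasDerivAt_pi.1 hB i) j
  refine hasDerivAt_pi.2 fun i => hasDerivAt_pi.2 fun j => ?_
  have h := HasDerivAt.fun_sum (u := Finset.univ) fun k _ => (hA' i k).mul (hB' k j)
  simpa only [Matrix.mul_apply, Matrix.add_apply, Finset.sum_add_distrib, Pi.mul_apply] using h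

theorem HasDerivAt.matrix_transpose {m n : Type*} [Fintype m] [Fintype n]
    {A : ℝ → Matrix m n ℂ} {A' : Matrix m n ℂ} {x : ℝ} (hA : HasDerivAt A A' x) :
    HasDerivAt (fun y => (A y)ᵀ) A'ᵀ x :=
  hasDerivAt_pi.2 fun i => hasDerivAt_pi.2 fun j => hasDerivAt_pi.1 (hasDerivAt_pi.1 hA j) i

theorem HasDerivAt.matrix_trace {n : Type*} [Fintype n]
    {A : ℝ → Matrix n n ℂ} {A' : Matrix n n ℂ} {x : ℝ} (hA : HasDerivAt A A' x) :
    HasDerivAt (fun y => (A y).trace) A'.trace x :=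
  HasDerivAt.fun_sum fun i _ => hasDerivAt_pi.1 (hasDerivAt_pi.1 hA i) i

theorem vecMulVec_mul_mul_vecMulVec {n R : Type*} [Fintype n] [CommRing R]
    (a b c d : n → R) (X : Matrix n n R) :
    vecMulVec a b * X * vecMulVec c d = (b ⬝ᵥ X *ᵥ c) • vecMulVec a d := by
  rw [Matrix.mul_assoc, mul_vecMulVec, vecMulVec_mul_vecMulVec, vecMulVec_smul]

theorem vecMulVec_mul_mul_self {n R : Type*} [Fintype n] [CommRing R]
    (a b : n → R) (X : Matrix n n R) :
    vecMulVec a b * X * vecMulVec a b = (X * vecMulVec a b).trace • vecMulVec a b := by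
  rw [vecMulVec_mul_mul_vecMulVec, mul_vecMulVec, trace_vecMulVec, dotProduct_comm]

theorem dotProduct_mulVec_self_of_skew {n : Type*} [Fintype n]
    (a : n → ℂ) (X : Matrix n n ℂ) (hX : Xᵀ = -X) : a ⬝ᵥ X *ᵥ a = 0 := by
  have h : a ⬝ᵥ X *ᵥ a = -(a ⬝ᵥ X *ᵥ a) := by
    conv_lhs => rw [dotProduct_mulVec, ← mulVec_transpose, hX, neg_mulVec, neg_dotProduct,
      dotProduct_comm]
  exact self_eq_neg.1 h

/-- The derivative of the normalized rank-one solution `(tr G)⁻¹ G`, where `G` intertwines the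
spectral problems at `lp` and `lm`. -/
theorem hasDerivAt_normalized_rankOne {n : Type*} [Fintype n]
    {G : ℝ → Matrix n n ℂ} {G' J q : Matrix n n ℂ} {lp lm : ℂ} {x : ℝ}
    {a b : n → ℂ} (hG : HasDerivAt G G' x) (hx : G x = vecMulVec a b)
    (hG' : Complex.I • G' = lp • (J * G x) - q * G x + G x * q - lm • (G x * J))
    (htr : (G x).trace ≠ 0) :
    ∃ P', HasDerivAt (fun y => (G y).trace⁻¹ • G y) P' x ∧
      Complex.I • P' = lp • (J * ((G x).trace⁻¹ • G x)) - q * ((G x).trace⁻¹ • G x)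
        + ((G x).trace⁻¹ • G x) * q - lm • (((G x).trace⁻¹ • G x) * J)
        - (lp - lm) • (((G x).trace⁻¹ • G x) * J * ((G x).trace⁻¹ • G x)) := by
  have hρ := hG.matrix_trace.fun_inv htr
  have hI : Complex.I * G'.trace = (lp - lm) * (J * G x).trace := by
    have := congrArg Matrix.trace hG'
    simp only [trace_smul, trace_sub, trace_add, smul_eq_mul] at this
    rw [this, trace_mul_comm q, trace_mul_comm (G x) J]
    ring
  refine ⟨_, hρ.smul hG, ?_⟩
  have hJ : G x * J * G x = (J * G x).trace • G x := by
    rw [hx, vecMulVec_mul_mul_self]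
  simp only [Matrix.smul_mul, Matrix.mul_smul, hJ]
  rw [smul_add, smul_comm Complex.I, hG', smul_smul Complex.I, mul_div_assoc', mul_neg, hI]
  simp only [smul_add, smul_sub, smul_smul]
  match_scalars <;> field_simp

/-- The algebraic part of the dressing computation. -/
theorem dressing_algebra {n : Type*} [Fintype n] {P m P' m' J q : Matrix n n ℂ} {lp lm : ℂ}
    (hP : P * P = P) (hm : m * m = m) (hmP : m * P = 0) (hPm : P * m = 0)
    (hmJP : m * J * P = 0) (hPJm : P * J * m = 0)
    (hP' : Complex.I • P' = lp • (J * P) - q * P + P * q - lm • (P * J)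
      - (lp - lm) • (P * J * P))
    (hm' : Complex.I • m' = lm • (J * m) - q * m + m * q - lp • (m * J)
      - (lm - lp) • (m * J * m)) :
    Complex.I • P' + (q + (lm - lp) • (J * (P - m) - (P - m) * J)) * P - P * q
      - lm • (J * P - P * J) = 0 ∧
    Complex.I • m' + (q + (lm - lp) • (J * (P - m) - (P - m) * J)) * m - m * q
      - lp • (J * m - m * J) = 0 := by
  constructor
  · rw [hP']
    simp only [Matrix.add_mul, Matrix.smul_mul, Matrix.sub_mul, Matrix.mul_sub, Matrix.mul_assoc J,
      hP, hmP, hmJP, Matrix.mul_zero]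
    module
  · rw [hm']
    simp only [Matrix.add_mul, Matrix.smul_mul, Matrix.sub_mul, Matrix.mul_sub, Matrix.mul_assoc J,
      hm, hPm, hPJm, Matrix.mul_zero]
    module

/-- Proposition 1, orthogonal case.  `lp` stands for `λ₁⁺`,
`lm` for `λ₁⁻`, `χp`/`χm` for `χ⁺`/`χ⁻` and `πm` for `π₋₁`. -/
theorem prop1_orthogonal_dressing {N : ℕ}
    (S J : Matrix (Fin N) (Fin N) ℂ)
    (hST : Sᵀ = S) (hS2 : S * S = 1)
    (hJ : S * Jᵀ * S⁻¹ = -J)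
    (q₀ : ℝ → Matrix (Fin N) (Fin N) ℂ) (hq₀ : Differentiable ℝ q₀)
    (hq₀S : ∀ x, S * (q₀ x)ᵀ * S⁻¹ = -q₀ x)
    (lp lm : ℂ)
    (χp χm : ℝ → Matrix (Fin N) (Fin N) ℂ)
    (hχp : Differentiable ℝ χp) (hχm : Differentiable ℝ χm)
    (hχpu : ∀ x, IsUnit (χp x).det) (hχmu : ∀ x, IsUnit (χm x).det)
    (hZSp : ∀ x, Complex.I • deriv χp x + q₀ x * χp x - lp • (J * χp x) = 0)
    (hZSm : ∀ x, Complex.I • deriv χm x + q₀ x * χm x - lm • (J * χm x) = 0)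
    (horthp : ∀ x, χp x * S * (χp x)ᵀ = S)
    (horthm : ∀ x, χm x * S * (χm x)ᵀ = S)
    (n₀ m₀ : Fin N → ℂ)
    (hm₀ : m₀ ⬝ᵥ S.mulVec m₀ = 0) (hn₀ : n₀ ⬝ᵥ S.mulVec n₀ = 0)
    (ρ : ℝ → ℂ)
    (hρdef : ∀ x, ρ x = m₀ ⬝ᵥ ((χm x)⁻¹ * χp x).mulVec n₀)
    (hρ : ∀ x, ρ x ≠ 0)
    (π₁ πm q₁ : ℝ → Matrix (Fin N) (Fin N) ℂ)
    (hπ₁ : ∀ x, π₁ x = (ρ x)⁻¹ •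
      vecMulVec ((χp x).mulVec n₀) (Matrix.vecMul m₀ (χm x)⁻¹))
    (hπm : ∀ x, πm x = S * (π₁ x)ᵀ * S⁻¹)
    (hq₁ : ∀ x, q₁ x = q₀ x + (lm - lp) •
      (J * (π₁ x - πm x) - (π₁ x - πm x) * J)) :
    ∀ x,
      Complex.I • deriv π₁ x + q₁ x * π₁ x - π₁ x * q₀ x
        - lm • (J * π₁ x - π₁ x * J) = 0 ∧
      Complex.I • deriv πm x + q₁ x * πm x - πm x * q₀ x
        - lp • (J * πm x - πm x * J) = 0 := by
  have hSi : S⁻¹ = S := Matrix.inv_eq_right_inv hS2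
  have hSS : ∀ X : Matrix (Fin N) (Fin N) ℂ, S * (S * X) = X := fun X => by
    rw [← Matrix.mul_assoc, hS2, Matrix.one_mul]
  rw [hSi] at hJ
  simp only [hSi] at hq₀S hπm
  have skew : ∀ X : Matrix (Fin N) (Fin N) ℂ, S * Xᵀ * S = -X → Xᵀ = -(S * X * S) := by
    intro X hX
    have h := congrArg (fun Y => S * Y * S) hX
    simpa only [Matrix.mul_neg, Matrix.neg_mul, Matrix.mul_assoc, hSS, hS2, Matrix.mul_one] using h
  have hJT := skew J hJ
  have hinv : ∀ X : Matrix (Fin N) (Fin N) ℂ, X * S * Xᵀ = S → X⁻¹ = S * Xᵀ * S := by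
    intro X hX
    refine Matrix.inv_eq_right_inv ?_
    rw [← Matrix.mul_assoc, ← Matrix.mul_assoc, hX, hS2]
  have horth' : ∀ X : Matrix (Fin N) (Fin N) ℂ, X * S * Xᵀ = S → Xᵀ * S * X = S := by
    intro X hX
    have h : S * Xᵀ * S * X = 1 := by
      rw [mul_eq_one_comm, ← Matrix.mul_assoc, ← Matrix.mul_assoc, hX, hS2]
    have h2 := congrArg (S * ·) h
    simpa only [Matrix.mul_assoc, hSS, Matrix.mul_one] using h2
  let G : ℝ → Matrix (Fin N) (Fin N) ℂ := fun y =>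
    χp y * vecMulVec n₀ m₀ * (S * (χm y)ᵀ * S)
  have hG : ∀ y, G y = vecMulVec ((χp y) *ᵥ n₀) (m₀ ᵥ* (χm y)⁻¹) := by
    intro y
    rw [hinv _ (horthm y)]
    simp only [G, mul_vecMulVec, vecMulVec_mul]
  have hGtr : ∀ y, (G y).trace = ρ y := by
    intro y
    rw [hG, trace_vecMulVec, hρdef, dotProduct_comm, ← dotProduct_mulVec, mulVec_mulVec]
  have hπG : π₁ = fun y => (G y).trace⁻¹ • G y := by
    funext y
    rw [hπ₁, hGtr, hG]
  intro x
  have hq := skew _ (hq₀S x)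
  have hdp : HasDerivAt χp (deriv χp x) x := (hχp x).hasDerivAt
  have hdm : HasDerivAt χm (deriv χm x) x := (hχm x).hasDerivAt
  have hip : Complex.I • deriv χp x = lp • (J * χp x) - q₀ x * χp x := by
    rw [← sub_eq_zero, ← hZSp x]; abel
  have him : Complex.I • deriv χm x = lm • (J * χm x) - q₀ x * χm x := by
    rw [← sub_eq_zero, ← hZSm x]; abel
  have himT : Complex.I • (deriv χm x)ᵀ = lm • ((χm x)ᵀ * Jᵀ) - (χm x)ᵀ * (q₀ x)ᵀ := by
    rw [← transpose_smul, him, transpose_sub, transpose_smul, transpose_mul, transpose_mul]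
  have hGd := (hdp.matrix_mul (hasDerivAt_const x (vecMulVec n₀ m₀))).matrix_mul
    (((hasDerivAt_const x S).matrix_mul hdm.matrix_transpose).matrix_mul (hasDerivAt_const x S))
  obtain ⟨P', hP'd, hP'⟩ := hasDerivAt_normalized_rankOne (G := G) (J := J) (q := q₀ x)
    (lp := lp) (lm := lm) hGd (hG x) (by
      simp only [Matrix.mul_zero, Matrix.zero_mul, add_zero, zero_add, smul_add]
      rw [← Matrix.smul_mul, ← Matrix.smul_mul, hip, ← Matrix.mul_smul (χp x * _),
        ← Matrix.smul_mul Complex.I (S * _), ← Matrix.mul_smul S, himT, hJT, hq]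
      simp only [G, Matrix.mul_sub, Matrix.sub_mul, Matrix.smul_mul, Matrix.mul_smul,
        Matrix.mul_neg, Matrix.neg_mul, Matrix.mul_assoc, hS2, Matrix.mul_one]
      module) (by rw [hGtr]; exact hρ x)
  have hval : (G x).trace⁻¹ • G x = π₁ x := by rw [hπG]
  rw [← hπG] at hP'd
  rw [hval] at hP'
  have hπm_fun : πm = fun y => S * (π₁ y)ᵀ * S := funext hπm
  have hmd : HasDerivAt πm (S * P'ᵀ * S) x := by
    have h := ((hasDerivAt_const x S).matrix_mul hP'd.matrix_transpose).matrix_mul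
      (hasDerivAt_const x S)
    simp only [Matrix.mul_zero, Matrix.zero_mul, add_zero, zero_add] at h
    rwa [hπm_fun]
  have hP_deriv : deriv π₁ x = P' := hP'd.deriv
  have hm_deriv : deriv πm x = S * P'ᵀ * S := hmd.deriv
  rw [hP_deriv, hm_deriv, hq₁]
  have hπx : π₁ x = (ρ x)⁻¹ • G x := by rw [hπ₁, hG]
  have hPP : π₁ x * π₁ x = π₁ x := by
    have h := vecMulVec_mul_mul_self ((χp x) *ᵥ n₀) (m₀ ᵥ* (χm x)⁻¹) 1
    rw [Matrix.mul_one, Matrix.one_mul, ← hG, hGtr] at h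
    rw [hπx, Matrix.smul_mul, Matrix.mul_smul, h, smul_smul (ρ x)⁻¹ (ρ x),
      inv_mul_cancel₀ (hρ x), one_smul]
  have hJS : (S * J)ᵀ = -(S * J) := by
    rw [transpose_mul, hST, hJT]
    simp only [Matrix.neg_mul, Matrix.mul_assoc, hS2, Matrix.mul_one]
  have hJS' : (J * S)ᵀ = -(J * S) := by
    rw [transpose_mul, hST, hJT]
    simp only [Matrix.mul_neg, Matrix.mul_assoc, hSS]
  have haS : ((χp x) *ᵥ n₀) ⬝ᵥ S *ᵥ ((χp x) *ᵥ n₀) = 0 := by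
    rw [dotProduct_mulVec, ← vecMul_transpose, vecMul_vecMul, ← dotProduct_mulVec,
      vecMul_transpose, mulVec_mulVec, horth' _ (horthp x), hn₀]
  have hbS : (m₀ ᵥ* (χm x)⁻¹) ⬝ᵥ S *ᵥ (m₀ ᵥ* (χm x)⁻¹) = 0 := by
    have hc : ∀ X, (χm x)ᵀ * (S * (χm x * X)) = S * X := fun X => by
      rw [← Matrix.mul_assoc S, ← Matrix.mul_assoc, ← Matrix.mul_assoc, horth' _ (horthm x)]
    have h : (χm x)⁻¹ * S * (χm x)⁻¹ᵀ = S := by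
      rw [hinv _ (horthm x)]
      simp only [transpose_mul, transpose_transpose, hST, Matrix.mul_assoc, hSS, hc]
    rw [← dotProduct_mulVec, ← mulVec_transpose, mulVec_mulVec, mulVec_mulVec, h, hm₀]
  have hmP : ∀ X : Matrix (Fin N) (Fin N) ℂ,
      ((χp x) *ᵥ n₀) ⬝ᵥ (S * X) *ᵥ ((χp x) *ᵥ n₀) = 0 → πm x * X * π₁ x = 0 := by
    intro X hX
    have h := vecMulVec_mul_mul_vecMulVec (m₀ ᵥ* (χm x)⁻¹) ((χp x) *ᵥ n₀) ((χp x) *ᵥ n₀)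
      (m₀ ᵥ* (χm x)⁻¹) (S * X)
    rw [hX, zero_smul, ← hG, ← transpose_vecMulVec, ← hG, Matrix.mul_assoc] at h
    rw [hπm, hπx]
    simp only [transpose_smul, Matrix.smul_mul, Matrix.mul_smul, Matrix.mul_assoc] at h ⊢
    rw [h, Matrix.mul_zero, smul_zero, smul_zero]
  have hPm : ∀ X : Matrix (Fin N) (Fin N) ℂ,
      (m₀ ᵥ* (χm x)⁻¹) ⬝ᵥ (X * S) *ᵥ (m₀ ᵥ* (χm x)⁻¹) = 0 → π₁ x * X * πm x = 0 := by
    intro X hX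
    have h := vecMulVec_mul_mul_vecMulVec ((χp x) *ᵥ n₀) (m₀ ᵥ* (χm x)⁻¹) (m₀ ᵥ* (χm x)⁻¹)
      ((χp x) *ᵥ n₀) (X * S)
    rw [hX, zero_smul, ← hG, ← transpose_vecMulVec, ← hG] at h
    rw [hπm, hπx]
    simp only [transpose_smul, Matrix.smul_mul, Matrix.mul_smul, ← Matrix.mul_assoc] at h ⊢
    rw [h, Matrix.zero_mul, smul_zero, smul_zero]
  refine dressing_algebra hPP ?_ ?_ ?_ ?_ ?_ hP' ?_
  · have h := congrArg Matrix.transpose hPP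
    rw [transpose_mul] at h
    rw [hπm]
    simp only [Matrix.mul_assoc, hSS]
    rw [← Matrix.mul_assoc (π₁ x)ᵀ, h]
  · have h := hmP 1 (by rwa [Matrix.mul_one])
    rwa [Matrix.mul_one] at h
  · have h := hPm 1 (by rwa [Matrix.one_mul])
    rwa [Matrix.mul_one] at h
  · exact hmP J (dotProduct_mulVec_self_of_skew _ _ hJS)
  · exact hPm J (dotProduct_mulVec_self_of_skew _ _ hJS')
  · rw [← Matrix.smul_mul, ← Matrix.mul_smul, ← transpose_smul, hP', hπm]
    simp only [transpose_sub, transpose_add, transpose_smul, transpose_mul, hJT, hq,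
      Matrix.mul_sub, Matrix.sub_mul, Matrix.mul_add, Matrix.add_mul, Matrix.smul_mul,
      Matrix.mul_smul, Matrix.mul_neg, Matrix.neg_mul, Matrix.mul_assoc, hSS, hS2, Matrix.mul_one]
    module
end

section
/- (Proposition 2, symplectic case.) Let S be an invertible N×N complex matrix with Sᵀ = −S and S² = −I. Let J ∈ M_N(ℂ) with SJᵀS⁻¹ = −J, and let q₀ : ℝ → M_N(ℂ) be differentiable with S q₀(x)ᵀ S⁻¹ = −q₀(x) for all x. Let λ₁⁺, λ₁⁻ ∈ ℂ and let χ⁺, χ⁻ : ℝ → GL_N(ℂ) be differentiable with χ±(x) S (χ±(x))ᵀ = S, satisfying i·(χ±)'(x) + q₀(x)χ±(x) − λ₁± J χ±(x) = 0. Let χ̇⁺, χ̇⁻ : ℝ → M_N(ℂ) be differentiable λ-derivatives: i·(χ̇±)'(x) + q₀(x)χ̇±(x) − λ₁± J χ̇±(x) − Jχ±(x) = 0 and χ̇±(x) S (χ±(x))ᵀ + χ±(x) S (χ̇±(x))ᵀ = 0 for all x. Fix constant vectors n₀, m₀ ∈ ℂ^N and define the column vector n(x) = χ⁺(x)n₀,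 the row vector m(x)ᵀ = m₀ᵀ χ⁻(x)⁻¹, the scalars ρ(x) = m(x)ᵀn(x), A(x) = −(λ₁⁻−λ₁⁺)·m₀ᵀ χ⁻(x)⁻¹ χ̇⁻(x) S m₀, B(x) = (λ₁⁻−λ₁⁺)·n₀ᵀ S χ⁺(x)⁻¹ χ̇⁺(x) n₀, and assume Δ(x) := ρ(x)² + A(x)B(x) ≠ 0 for all x. Define π₁(x) = (ρ(x)n(x) + B(x)Sm(x))·m(x)ᵀ / Δ(x), π₋₁(x) = S(ρ(x)m(x) + A(x)Sn(x))·n(x)ᵀ S⁻¹ / Δ(x), and q₁(x) = q₀(x) + (λ₁⁻ − λ₁⁺)[J, π₁(x) − π₋₁(x)]. Then for all x: i·π₁'(x) + q₁(x)π₁(x) − π₁(x)q₀(x) − λ₁⁻[J, π₁(x)] = 0 and i·π₋₁'(x) + q₁(x)π₋₁(x) − π₋₁(x)q₀(x) − λ₁⁺[J, π₋₁(x)] = 0. -/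
open Matrix

attribute [local instance] Matrix.normedAddCommGroup Matrix.normedSpace

/-- A vector-valued curve built by applying a differentiable matrix curve to a constant vector. -/
theorem hasDerivAt_mulVec_const {N : ℕ} {F : ℝ → Matrix (Fin N) (Fin N) ℂ} {x : ℝ}
    (hF : DifferentiableAt ℝ F x) (v : Fin N → ℂ) :
    HasDerivAt (fun t => F t *ᵥ v) (deriv F x *ᵥ v) x := by
  have h : ∀ i j, HasDerivAt (fun t => F t i j) (deriv F x i j) x := fun i j =>
    hasDerivAt_pi.1 (hasDerivAt_pi.1 hF.hasDerivAt i) j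
  refine hasDerivAt_pi.2 fun i => ?_
  simp only [mulVec, dotProduct]
  exact HasDerivAt.fun_sum fun j _ => (h i j).mul_const (v j)

theorem hasDerivAt_const_mulVec {N : ℕ} (M : Matrix (Fin N) (Fin N) ℂ) {f : ℝ → Fin N → ℂ}
    {f' : Fin N → ℂ} {x : ℝ} (hf : HasDerivAt f f' x) :
    HasDerivAt (fun t => M *ᵥ f t) (M *ᵥ f') x := by
  refine hasDerivAt_pi.2 fun i => ?_
  simp only [mulVec, dotProduct]
  exact HasDerivAt.fun_sum fun j _ => (hasDerivAt_pi.1 hf j).const_mul (M i j)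

theorem hasDerivAt_dotProduct {N : ℕ} {f g : ℝ → Fin N → ℂ} {f' g' : Fin N → ℂ} {x : ℝ}
    (hf : HasDerivAt f f' x) (hg : HasDerivAt g g' x) :
    HasDerivAt (fun t => f t ⬝ᵥ g t) (f' ⬝ᵥ g x + f x ⬝ᵥ g') x := by
  simp only [dotProduct, ← Finset.sum_add_distrib]
  exact HasDerivAt.fun_sum fun j _ => (hasDerivAt_pi.1 hf j).mul (hasDerivAt_pi.1 hg j)

/-- The equation of a rank-one dressing projector, in terms of a dual pair of solutions. -/
theorem dressing_equation {N : ℕ} (J q : Matrix (Fin N) (Fin N) ℂ) (lp lm : ℂ)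
    {p r α β : ℝ → Fin N → ℂ} {ρ A B : ℝ → ℂ} {x : ℝ}
    (hp : HasDerivAt p (-Complex.I • (lp • (J *ᵥ p x) - q *ᵥ p x)) x)
    (hr : HasDerivAt r (-Complex.I • (lm • (J *ᵥ r x) - q *ᵥ r x)) x)
    (hα : HasDerivAt α (-Complex.I • (α x ᵥ* q - lm • (α x ᵥ* J))) x)
    (hρ : HasDerivAt ρ (-Complex.I * (-(lm - lp) * (α x ⬝ᵥ J *ᵥ p x))) x)
    (hA : HasDerivAt A (-Complex.I * (-(lm - lp) * (α x ⬝ᵥ J *ᵥ r x))) x)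
    (hB : HasDerivAt B (-Complex.I * ((lm - lp) * (β x ⬝ᵥ J *ᵥ p x))) x)
    (hJ : β x ⬝ᵥ J *ᵥ r x = α x ⬝ᵥ J *ᵥ p x)
    (hαp : α x ⬝ᵥ p x = ρ x) (hαr : α x ⬝ᵥ r x = 0)
    (hβp : β x ⬝ᵥ p x = 0) (hβr : β x ⬝ᵥ r x = -ρ x)
    (hΔ : ρ x ^ 2 + A x * B x ≠ 0)
    {π₁ : ℝ → Matrix (Fin N) (Fin N) ℂ} {P : Matrix (Fin N) (Fin N) ℂ}
    (hπ : ∀ t, π₁ t = (ρ t ^ 2 + A t * B t)⁻¹ • vecMulVec (ρ t • p t + B t • r t) (α t))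
    (hP : P = π₁ x - (ρ x ^ 2 + A x * B x)⁻¹ • vecMulVec (A x • p x - ρ x • r x) (β x)) :
    Complex.I • deriv π₁ x + (q + (lm - lp) • (J * P - P * J)) * π₁ x - π₁ x * q
      - lm • (J * π₁ x - π₁ x * J) = 0 := by
  have hD := (hρ.pow 2).add (hA.mul hB)
  have hDi := hD.inv hΔ
  have hu : ∀ i, HasDerivAt (fun t => ρ t * p t i + B t * r t i) _ x := fun i =>
    (hρ.mul (hasDerivAt_pi.1 hp i)).add (hB.mul (hasDerivAt_pi.1 hr i))
  have hent : ∀ i j, HasDerivAt (fun t => π₁ t i j) _ x := fun i j => by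
    have h := hDi.mul ((hu i).mul (hasDerivAt_pi.1 hα j))
    refine h.congr_of_eventuallyEq (Filter.Eventually.of_forall fun t => ?_)
    simp [hπ, vecMulVec_apply]
  have hmat : ∀ i j, deriv π₁ x i j = deriv (fun t => π₁ t i j) x := fun i j => by
    have h : HasDerivAt π₁ (fun i j => deriv (fun t => π₁ t i j) x) x :=
      hasDerivAt_pi.2 fun i => hasDerivAt_pi.2 fun j => (hent i j).differentiableAt.hasDerivAt
    exact congrFun (congrFun (HasDerivAt.deriv h) i) j
  have hPu : P *ᵥ (ρ x • p x + B x • r x) = ρ x • p x := by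
    ext i
    simp [-mulVec_mulVec, hP, hπ, sub_mulVec, smul_mulVec, vecMulVec_mulVec, dotProduct_add, hαp,
      hαr, hβp, hβr]
    field_simp
    ring
  have hPJu : P *ᵥ (J *ᵥ (ρ x • p x + B x • r x)) = (ρ x ^ 2 + A x * B x)⁻¹ •
      ((ρ x * (α x ⬝ᵥ J *ᵥ p x) + B x * (α x ⬝ᵥ J *ᵥ r x)) • (ρ x • p x + B x • r x)
      - (ρ x * (β x ⬝ᵥ J *ᵥ p x) + B x * (α x ⬝ᵥ J *ᵥ p x)) • (A x • p x - ρ x • r x)) := by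
    ext i
    simp [-mulVec_mulVec, hP, hπ, sub_mulVec, smul_mulVec, vecMulVec_mulVec, mulVec_add,
      mulVec_smul, hJ]
    ring
  have key : (q + (lm - lp) • (J * P - P * J)) * π₁ x = (ρ x ^ 2 + A x * B x)⁻¹ •
      vecMulVec (q *ᵥ (ρ x • p x + B x • r x) + (lm - lp) •
        (J *ᵥ (P *ᵥ (ρ x • p x + B x • r x)) - P *ᵥ (J *ᵥ (ρ x • p x + B x • r x)))) (α x) := by
    rw [hπ x, mul_smul_comm, mul_vecMulVec, add_mulVec, smul_mulVec, sub_mulVec, mulVec_mulVec,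
      mulVec_mulVec]
  rw [key, hPu, hPJu]
  ext i j
  rw [hπ x]
  simp [-mulVec_mulVec, hmat, (hent i j).deriv, mul_vecMulVec, vecMulVec_mul,
    vecMulVec_apply, mulVec_add, mulVec_smul]
  clear hmat hent hu hDi hD hp hr hα hρ hA hB key hPu hPJu hπ hP
  field_simp
  ring_nf
  simp only [Complex.I_sq]
  ring

theorem zs_hasDerivAt_mulVec {N : ℕ} {J q G : Matrix (Fin N) (Fin N) ℂ} {l : ℂ}
    {X : ℝ → Matrix (Fin N) (Fin N) ℂ} {x : ℝ} (hX : Differentiable ℝ X)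
    (h : Complex.I • deriv X x + q * X x - l • (J * X x) - G = 0) (v : Fin N → ℂ) :
    HasDerivAt (fun t => X t *ᵥ v)
      (-Complex.I • (l • (J *ᵥ (X x *ᵥ v)) - q *ᵥ (X x *ᵥ v) + G *ᵥ v)) x := by
  have hd : deriv X x = -Complex.I • (l • (J * X x) - q * X x + G) := by
    have h' : Complex.I • deriv X x = l • (J * X x) - q * X x + G := by
      rw [← sub_eq_zero, ← h]
      abel
    rw [← h', smul_smul, neg_mul, Complex.I_mul_I, neg_neg, one_smul]
  convert hasDerivAt_mulVec_const (hX x) v using 1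
  rw [hd, smul_mulVec, add_mulVec, sub_mulVec, smul_mulVec, mulVec_mulVec, mulVec_mulVec]

/-- Skewing a solution of the linear system by `S` gives a solution of the adjoint system. -/
theorem hasDerivAt_adjoint_solution {N : ℕ} {S J q : Matrix (Fin N) (Fin N) ℂ} {l : ℂ}
    (hJ : S * J = -(Jᵀ * S)) (hq : S * q = -(qᵀ * S))
    {y z : ℝ → Fin N → ℂ} {x : ℝ}
    (hz : HasDerivAt z (-Complex.I • (l • (J *ᵥ z x) - q *ᵥ z x)) x)
    (hy : ∀ t, y t = -S *ᵥ z t) :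
    HasDerivAt y (-Complex.I • (y x ᵥ* q - l • (y x ᵥ* J))) x := by
  obtain rfl : y = fun t => -S *ᵥ z t := funext hy
  convert hasDerivAt_const_mulVec (-S) hz using 1
  simp only [← mulVec_transpose, mulVec_smul, mulVec_sub, mulVec_mulVec, neg_mul, hJ, hq, neg_neg,
    neg_mulVec, mulVec_neg]
  module

/-- The pairing of an adjoint solution with a solution of the inhomogeneous system. -/
theorem hasDerivAt_pairing {N : ℕ} {J q : Matrix (Fin N) (Fin N) ℂ} {l : ℂ}
    {y z : ℝ → Fin N → ℂ} {g : Fin N → ℂ} {x : ℝ}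
    (hy : HasDerivAt y (-Complex.I • (y x ᵥ* q - l • (y x ᵥ* J))) x)
    (hz : HasDerivAt z (-Complex.I • (l • (J *ᵥ z x) - q *ᵥ z x + g)) x) :
    HasDerivAt (fun t => y t ⬝ᵥ z t) (-Complex.I * (y x ⬝ᵥ g)) x := by
  convert hasDerivAt_dotProduct hy hz using 1
  simp only [smul_dotProduct, dotProduct_smul, sub_dotProduct, dotProduct_sub, dotProduct_add,
    dotProduct_mulVec, smul_eq_mul]
  ring

/-- The symmetry relation `S Mᵀ S⁻¹ = -M` in a form free of inverses. -/
theorem mul_eq_neg_transpose_mul {N : ℕ} {S M : Matrix (Fin N) (Fin N) ℂ} (hS2 : S * S = -1)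
    (hSinv : S⁻¹ = -S) (h : S * Mᵀ * S⁻¹ = -M) : S * M = -(Mᵀ * S) := by
  have h' : S * Mᵀ * S = M := by simpa [hSinv] using h
  calc S * M = S * (S * Mᵀ * S) := by rw [h']
    _ = S * S * (Mᵀ * S) := by simp only [Matrix.mul_assoc]
    _ = -(Mᵀ * S) := by rw [hS2, neg_one_mul]

/-- Proposition 2, symplectic case.  `lp` stands for `λ₁⁺`,
`lm` for `λ₁⁻`; `χp`/`χm` for `χ⁺`/`χ⁻`; `χdp`/`χdm` for the λ-derivatives
`χ̇⁺`/`χ̇⁻`; `nn`/`mm` for the vectors `n(x)`/`m(x)`; `πm` for `π₋₁`. -/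
theorem prop2_symplectic_dressing {N : ℕ}
    (S J : Matrix (Fin N) (Fin N) ℂ)
    (hST : Sᵀ = -S) (hS2 : S * S = -1)
    (hJ : S * Jᵀ * S⁻¹ = -J)
    (q₀ : ℝ → Matrix (Fin N) (Fin N) ℂ) (hq₀ : Differentiable ℝ q₀)
    (hq₀S : ∀ x, S * (q₀ x)ᵀ * S⁻¹ = -q₀ x)
    (lp lm : ℂ)
    (χp χm : ℝ → Matrix (Fin N) (Fin N) ℂ)
    (hχp : Differentiable ℝ χp) (hχm : Differentiable ℝ χm)
    (hχpu : ∀ x, IsUnit (χp x).det) (hχmu : ∀ x, IsUnit (χm x).det)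
    (horthp : ∀ x, χp x * S * (χp x)ᵀ = S)
    (horthm : ∀ x, χm x * S * (χm x)ᵀ = S)
    (hZSp : ∀ x, Complex.I • deriv χp x + q₀ x * χp x - lp • (J * χp x) = 0)
    (hZSm : ∀ x, Complex.I • deriv χm x + q₀ x * χm x - lm • (J * χm x) = 0)
    (χdp χdm : ℝ → Matrix (Fin N) (Fin N) ℂ)
    (hχdp : Differentiable ℝ χdp) (hχdm : Differentiable ℝ χdm)
    (hZSdp : ∀ x, Complex.I • deriv χdp x + q₀ x * χdp x - lp • (J * χdp x)
      - J * χp x = 0)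
    (hZSdm : ∀ x, Complex.I • deriv χdm x + q₀ x * χdm x - lm • (J * χdm x)
      - J * χm x = 0)
    (hsymp : ∀ x, χdp x * S * (χp x)ᵀ + χp x * S * (χdp x)ᵀ = 0)
    (hsymm : ∀ x, χdm x * S * (χm x)ᵀ + χm x * S * (χdm x)ᵀ = 0)
    (n₀ m₀ : Fin N → ℂ)
    (nn mm : ℝ → Fin N → ℂ)
    (hn : ∀ x, nn x = (χp x).mulVec n₀)
    (hm : ∀ x, mm x = Matrix.vecMul m₀ (χm x)⁻¹)
    (ρ A B Δ : ℝ → ℂ)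
    (hρ : ∀ x, ρ x = mm x ⬝ᵥ nn x)
    (hA : ∀ x, A x = -(lm - lp) * (m₀ ⬝ᵥ ((χm x)⁻¹ * χdm x * S).mulVec m₀))
    (hB : ∀ x, B x = (lm - lp) * (n₀ ⬝ᵥ (S * (χp x)⁻¹ * χdp x).mulVec n₀))
    (hΔ : ∀ x, Δ x = (ρ x) ^ 2 + A x * B x)
    (hΔne : ∀ x, Δ x ≠ 0)
    (π₁ πm q₁ : ℝ → Matrix (Fin N) (Fin N) ℂ)
    (hπ₁ : ∀ x, π₁ x = (Δ x)⁻¹ •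
      vecMulVec (ρ x • nn x + B x • S.mulVec (mm x)) (mm x))
    (hπm : ∀ x, πm x = (Δ x)⁻¹ •
      (S * vecMulVec (ρ x • mm x + A x • S.mulVec (nn x)) (nn x) * S⁻¹))
    (hq₁ : ∀ x, q₁ x = q₀ x + (lm - lp) •
      (J * (π₁ x - πm x) - (π₁ x - πm x) * J)) :
    ∀ x,
      Complex.I • deriv π₁ x + q₁ x * π₁ x - π₁ x * q₀ x
        - lm • (J * π₁ x - π₁ x * J) = 0 ∧
      Complex.I • deriv πm x + q₁ x * πm x - πm x * q₀ x
        - lp • (J * πm x - πm x * J) = 0 := by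
  have hSinv : S⁻¹ = -S := inv_eq_right_inv (by simp [hS2])
  have hJS := mul_eq_neg_transpose_mul hS2 hSinv hJ
  have hqS := fun x => mul_eq_neg_transpose_mul hS2 hSinv (hq₀S x)
  have hinv : ∀ M : Matrix (Fin N) (Fin N) ℂ, M * S * Mᵀ = S → M⁻¹ = -(S * Mᵀ * S) := by
    intro M hM
    refine inv_eq_right_inv ?_
    rw [mul_neg, ← Matrix.mul_assoc, ← Matrix.mul_assoc, hM, hS2, neg_neg]
  have hr : ∀ t, S *ᵥ mm t = χm t *ᵥ (S *ᵥ m₀) := by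
    intro t
    rw [hm, ← mulVec_transpose, hinv _ (horthm t)]
    simp only [transpose_neg, transpose_mul, transpose_transpose, hST, mulVec_mulVec, neg_mul,
      mul_neg, neg_neg, ← Matrix.mul_assoc, hS2, Matrix.one_mul]
  have hSS : ∀ v, S *ᵥ (S *ᵥ v) = -v := by
    intro v
    rw [mulVec_mulVec, hS2, neg_mulVec, one_mulVec]
  have hskew : ∀ v w, v ⬝ᵥ S *ᵥ w = -(w ⬝ᵥ S *ᵥ v) := by
    intro v w
    rw [dotProduct_mulVec, ← mulVec_transpose, hST, dotProduct_comm, neg_mulVec, dotProduct_neg]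
  have hself : ∀ v, v ⬝ᵥ S *ᵥ v = 0 := fun v => self_eq_neg.1 (hskew v v)
  have hAeq : ∀ t, A t = -(lm - lp) * (mm t ⬝ᵥ χdm t *ᵥ (S *ᵥ m₀)) := by
    intro t
    rw [hA, hm, ← dotProduct_mulVec, mulVec_mulVec, mulVec_mulVec, Matrix.mul_assoc]
  have hBeq : ∀ t, B t = (lm - lp) * (-S *ᵥ nn t ⬝ᵥ χdp t *ᵥ n₀) := by
    intro t
    have h : S * (χp t)⁻¹ = (χp t)ᵀ * S := by
      rw [hinv _ (horthp t), mul_neg, ← Matrix.mul_assoc, ← Matrix.mul_assoc, hS2]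
      simp
    rw [hB, hn, h, ← hST, mulVec_transpose, ← dotProduct_mulVec, ← vecMul_transpose (χp t),
      ← dotProduct_mulVec, mulVec_mulVec, mulVec_mulVec]
  intro x
  have hΔx : ρ x ^ 2 + A x * B x ≠ 0 := hΔ x ▸ hΔne x
  have dp : HasDerivAt nn (-Complex.I • (lp • (J *ᵥ nn x) - q₀ x *ᵥ nn x)) x := by
    obtain rfl : nn = fun t => χp t *ᵥ n₀ := funext hn
    simpa using zs_hasDerivAt_mulVec (G := 0) hχp (by simpa using hZSp x) n₀
  have dr : HasDerivAt (fun t => S *ᵥ mm t)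
      (-Complex.I • (lm • (J *ᵥ (S *ᵥ mm x)) - q₀ x *ᵥ (S *ᵥ mm x))) x := by
    simp only [hr]
    simpa using zs_hasDerivAt_mulVec (G := 0) hχm (by simpa using hZSm x) (S *ᵥ m₀)
  have dα := hasDerivAt_adjoint_solution (y := mm) hJS (hqS x) dr
    fun t => by rw [neg_mulVec, hSS, neg_neg]
  have dβ := hasDerivAt_adjoint_solution (y := fun t => -S *ᵥ nn t) hJS (hqS x) dp fun _ => rfl
  have dpd := zs_hasDerivAt_mulVec hχdp (hZSdp x) n₀
  have drd := zs_hasDerivAt_mulVec hχdm (hZSdm x) (S *ᵥ m₀)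
  rw [← mulVec_mulVec, ← hn] at dpd
  rw [← mulVec_mulVec, ← hr] at drd
  have dρ : HasDerivAt ρ (-Complex.I * (-(lm - lp) * (mm x ⬝ᵥ J *ᵥ nn x))) x := by
    obtain rfl : ρ = fun t => mm t ⬝ᵥ nn t := funext hρ
    have h := hasDerivAt_pairing (z := nn) (g := -(lm - lp) • (J *ᵥ nn x)) dα
      (dp.congr_deriv (by module))
    rwa [dotProduct_smul, smul_eq_mul] at h
  have dA : HasDerivAt A (-Complex.I * (-(lm - lp) * (mm x ⬝ᵥ J *ᵥ (S *ᵥ mm x)))) x := by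
    rw [funext hAeq]
    exact ((hasDerivAt_pairing dα drd).const_mul (-(lm - lp))).congr_deriv (by ring)
  have dB : HasDerivAt B (-Complex.I * ((lm - lp) * (-S *ᵥ nn x ⬝ᵥ J *ᵥ nn x))) x := by
    rw [funext hBeq]
    exact ((hasDerivAt_pairing dβ dpd).const_mul (lm - lp)).congr_deriv (by ring)
  have hJr : -S *ᵥ nn x ⬝ᵥ J *ᵥ (S *ᵥ mm x) = mm x ⬝ᵥ J *ᵥ nn x := by
    rw [dotProduct_comm, neg_mulVec, dotProduct_neg, ← hskew, mulVec_mulVec, hJS, neg_mulVec,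
      ← mulVec_mulVec, hSS, mulVec_neg, neg_neg, mulVec_transpose, dotProduct_comm,
      ← dotProduct_mulVec]
  have hβp : -S *ᵥ nn x ⬝ᵥ nn x = 0 := by
    rw [dotProduct_comm, neg_mulVec, dotProduct_neg, hself, neg_zero]
  have hβr : -S *ᵥ nn x ⬝ᵥ S *ᵥ mm x = -ρ x := by
    rw [dotProduct_comm, neg_mulVec, dotProduct_neg, ← hskew, hSS, dotProduct_neg, hρ,
      dotProduct_comm]
  have hπ₁' : ∀ t, π₁ t = (ρ t ^ 2 + A t * B t)⁻¹ •
      vecMulVec (ρ t • nn t + B t • S *ᵥ mm t) (mm t) := fun t => by rw [hπ₁, hΔ]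
  have hπm' : ∀ t, πm t = ((-ρ t) ^ 2 + B t * A t)⁻¹ •
      vecMulVec ((-ρ t) • S *ᵥ mm t + A t • nn t) (-S *ᵥ nn t) := by
    intro t
    rw [hπm, hΔ, hSinv, mul_vecMulVec, vecMulVec_mul, neg_sq, mul_comm (A t), ← mulVec_transpose,
      transpose_neg, hST, neg_neg, mulVec_add, mulVec_smul, mulVec_smul, hSS, neg_mulVec]
    ext i j
    simp only [Matrix.smul_apply, vecMulVec_apply, Pi.add_apply, Pi.smul_apply, Pi.neg_apply, smul_eq_mul]
    ring
  constructor
  · rw [hq₁]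
    refine dressing_equation (r := fun t => S *ᵥ mm t) (β := fun t => -S *ᵥ nn t) J (q₀ x) lp lm
      dp dr dα dρ dA dB hJr (hρ x).symm (hself _) hβp hβr hΔx hπ₁' ?_
    rw [hπm' x, neg_sq, mul_comm (B x), neg_smul, neg_add_eq_sub]
  · have hcomm : (lm - lp) • (J * (π₁ x - πm x) - (π₁ x - πm x) * J) =
        (lp - lm) • (J * (πm x - π₁ x) - (πm x - π₁ x) * J) := by
      rw [← neg_sub (π₁ x) (πm x), ← neg_sub lm lp]
      simp only [mul_neg, neg_mul, neg_smul]
      module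
    rw [hq₁, hcomm]
    refine dressing_equation (ρ := fun t => -ρ t) (p := fun t => S *ᵥ mm t) (β := mm) J (q₀ x) lm lp
      dr dp dβ ?_ ?_ ?_ hJr.symm hβr hβp (hself _) ?_ ?_ hπm' ?_
    · exact dρ.neg.congr_deriv (by rw [hJr]; ring)
    · exact dB.congr_deriv (by ring)
    · exact dA.congr_deriv (by ring)
    · rw [neg_neg, hρ]
    · rwa [neg_sq, mul_comm (B x)]
    · rw [hπ₁' x, neg_sq, mul_comm (B x), neg_smul, sub_neg_eq_add, add_comm (B x • _)]
end
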